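/- arXiv:1107.3776 — 4 statements merged into one kernel-verified Lean document; each statement's English description precedes it below -/
import Mathlib

section
/- There is an absolute constant C > 0 such that for every ε > 0 there exists δ > 0 with the following property. Let N, q₀, q, K₁ be positive integers with q₀ ≤ q, K₁ ≤ N, and q·q₀² ≤ δ·K₁, and let f : {1,…,N} → ℂ. Then ∑_{n=1}^{N} |f(n) − (E_{q,K₁}f)(n)| ≤ C·N^{1/2}·( ∫_{[0,1]∖𝔐̃} |f̂(θ)|² dθ )^{1/2} + ε·∑_{n=1}^{N} |f(n)|, where 𝔐̃ = ∪_{a=1}^{q} [a/q − q₀/N, a/q + q₀/N] (taken modulo 1). -/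
open scoped Classical

/-- The finite Fourier transform `f̂(θ) = ∑_{n=1}^N f(n) e^{2πinθ}`. -/
noncomputable def fhat (N : ℕ) (f : ℕ → ℂ) (θ : ℝ) : ℂ :=
  ∑ n ∈ Finset.Icc 1 N, f n * Complex.exp (2 * Real.pi * Complex.I * (n : ℂ) * (θ : ℂ))

/-- The index `j ∈ {1,…,K₁}` of the archimedean cell containing `n`: `j` is characterised by
`(j−1)·N/K₁ ≤ n < j·N/K₁`, with `n = N` placed in the cell with `j = K₁`. -/
def cellIdx (N K₁ n : ℕ) : ℕ := min K₁ (n * K₁ / N + 1)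

/-- The cell `ω_{j,a}` of the partition of `{1,…,N}` containing `n`: those `m ∈ {1,…,N}` with
the same archimedean index and the same residue mod `q` as `n`. -/
def cell (N K₁ q n : ℕ) : Finset ℕ :=
  (Finset.Icc 1 N).filter (fun m => cellIdx N K₁ m = cellIdx N K₁ n ∧ m % q = n % q)

/-- The conditional expectation `E_{q,K₁}f` of `f` with respect to the partition of `{1,…,N}`
into the cells `ω_{j,a}`: the average of `f` over the cell containing `n`. -/
noncomputable def condExp (N K₁ q : ℕ) (f : ℕ → ℂ) (n : ℕ) : ℂ :=
  (∑ m ∈ cell N K₁ q n, f m) / ((cell N K₁ q n).card : ℂ)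

open MeasureTheory hiding condExp
open ComplexConjugate

noncomputable def ee (n : ℕ) (θ : ℝ) : ℂ := Complex.exp (2 * Real.pi * Complex.I * (n : ℂ) * (θ : ℂ))

lemma ee_cont (n : ℕ) : Continuous (ee n) := by unfold ee; fun_prop

lemma fhat_eq (N : ℕ) (f : ℕ → ℂ) (θ : ℝ) : fhat N f θ = ∑ n ∈ Finset.Icc 1 N, f n * ee n θ := rfl

lemma fhat_cont (N : ℕ) (f : ℕ → ℂ) : Continuous (fhat N f) := by unfold fhat; fun_prop

lemma ee_form (n : ℕ) (θ : ℝ) : ee n θ = Complex.exp (((2 * Real.pi * n * θ : ℝ) : ℂ) * Complex.I) := by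
  unfold ee; congr 1; push_cast; ring

lemma ee_norm (n : ℕ) (θ : ℝ) : ‖ee n θ‖ = 1 := by
  rw [ee_form, Complex.norm_exp_ofReal_mul_I]

lemma ee_conj (n : ℕ) (θ : ℝ) :
    conj (ee n θ) = Complex.exp (-((2 * Real.pi * n * θ : ℝ) : ℂ) * Complex.I) := by
  rw [ee_form, ← Complex.exp_conj, map_mul, Complex.conj_I, Complex.conj_ofReal]
  congr 1; ring

lemma ee_mul_conj (n m : ℕ) (θ : ℝ) :
    ee n θ * conj (ee m θ)
      = Complex.exp ((2 * Real.pi * Complex.I * ((n : ℤ) - (m : ℤ) : ℤ)) * (θ : ℂ)) := by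
  rw [ee_conj, ee_form, ← Complex.exp_add]; congr 1; push_cast; ring

lemma ci {g : ℝ → ℂ} (hg : Continuous g) {S : Set ℝ} (hS : S ⊆ Set.Icc 0 1) :
    IntegrableOn g S := (hg.integrableOn_Icc).mono_set hS

lemma cir {g : ℝ → ℝ} (hg : Continuous g) {S : Set ℝ} (hS : S ⊆ Set.Icc 0 1) :
    IntegrableOn g S := (hg.integrableOn_Icc).mono_set hS

lemma conj_cont {g : ℝ → ℂ} (hg : Continuous g) : Continuous (fun x => conj (g x)) :=
  Complex.continuous_conj.comp hg

lemma orth (n m : ℕ) :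
    ∫ θ in Set.Icc (0:ℝ) 1, ee n θ * conj (ee m θ) = if n = m then 1 else 0 := by
  simp_rw [ee_mul_conj]
  rw [integral_Icc_eq_integral_Ioc, ← intervalIntegral.integral_of_le zero_le_one]
  split_ifs with h
  · subst h; simp
  · have hne : (2 * Real.pi * Complex.I * (((n : ℤ) - (m : ℤ) : ℤ) : ℂ)) ≠ 0 := by
      refine mul_ne_zero Complex.two_pi_I_ne_zero ?_
      have : ((n : ℤ) - (m : ℤ)) ≠ 0 := by omega
      exact_mod_cast this
    rw [integral_exp_mul_complex hne]
    have : Complex.exp ((2 * Real.pi * Complex.I * (((n : ℤ) - (m : ℤ) : ℤ) : ℂ)) * ((1:ℝ):ℂ)) = 1 := by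
      rw [Complex.exp_eq_one_iff]
      exact ⟨(n:ℤ) - m, by push_cast; ring⟩
    rw [this]; simp

lemma coeff (N : ℕ) (f : ℕ → ℂ) {n : ℕ} (hn : n ∈ Finset.Icc 1 N) :
    ∫ θ in Set.Icc (0:ℝ) 1, fhat N f θ * conj (ee n θ) = f n := by
  simp_rw [fhat_eq, Finset.sum_mul, mul_assoc]
  rw [integral_finset_sum]
  · simp_rw [integral_const_mul, orth]
    simp only [mul_ite, mul_one, mul_zero, Finset.sum_ite_eq', if_pos hn]
  · intro i _
    exact ci (continuous_const.mul ((ee_cont i).mul (conj_cont (ee_cont n)))) le_rfl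

lemma int_mul_conj (N : ℕ) (c : ℕ → ℂ) {g : ℝ → ℂ} (hg : Continuous g) {S : Set ℝ}
    (hS : S ⊆ Set.Icc 0 1) :
    ∫ θ in S, g θ * conj (fhat N c θ)
      = ∑ n ∈ Finset.Icc 1 N, conj (c n) * ∫ θ in S, g θ * conj (ee n θ) := by
  simp_rw [fhat_eq, map_sum, map_mul, Finset.mul_sum]
  rw [integral_finset_sum]
  · refine Finset.sum_congr rfl fun i _ => ?_
    rw [← integral_const_mul]
    congr 1; ext θ; ring
  · intro i _
    exact ci (hg.mul (continuous_const.mul (conj_cont (ee_cont i)))) hS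

lemma parseval (N : ℕ) (c : ℕ → ℂ) :
    ∫ θ in Set.Icc (0:ℝ) 1, ‖fhat N c θ‖ ^ 2 = ∑ n ∈ Finset.Icc 1 N, ‖c n‖ ^ 2 := by
  have h := int_mul_conj N c (fhat_cont N c) (le_refl (Set.Icc (0:ℝ) 1))
  rw [Finset.sum_congr rfl (fun n hn => by rw [coeff N c hn])] at h
  simp_rw [Complex.mul_conj', Complex.conj_mul'] at h
  have h2 : ∫ θ in Set.Icc (0:ℝ) 1, ((‖fhat N c θ‖ ^ 2 : ℝ) : ℂ)
      = ((∑ n ∈ Finset.Icc 1 N, ‖c n‖ ^ 2 : ℝ) : ℂ) := by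
    push_cast; exact h
  rw [integral_complex_ofReal] at h2
  exact_mod_cast h2

lemma bessel (N : ℕ) {g : ℝ → ℂ} (hg : Continuous g) {S : Set ℝ} 
    (hS : S ⊆ Set.Icc 0 1) (c : ℕ → ℂ) (hc : ∀ n, c n = ∫ θ in S, g θ * conj (ee n θ)) :
    ∑ n ∈ Finset.Icc 1 N, ‖c n‖ ^ 2 ≤ ∫ θ in S, ‖g θ‖ ^ 2 := by
  have h := int_mul_conj N c hg hS
  simp_rw [← hc, Complex.conj_mul'] at h
  have hn : ∑ n ∈ Finset.Icc 1 N, ‖c n‖ ^ 2 = ‖∫ θ in S, g θ * conj (fhat N c θ)‖ := by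
    rw [h]
    have : (∑ n ∈ Finset.Icc 1 N, (‖c n‖ : ℂ) ^ 2) = ((∑ n ∈ Finset.Icc 1 N, ‖c n‖ ^ 2 : ℝ) : ℂ) := by
      push_cast; rfl
    rw [this, Complex.norm_real, Real.norm_of_nonneg (by positivity)]
  have hP := fhat_cont N c
  have i1 : IntegrableOn (fun θ => ‖g θ‖ ^ 2) S := cir (by fun_prop) hS
  have i2 : IntegrableOn (fun θ => ‖fhat N c θ‖ ^ 2) S := cir (by fun_prop) hS
  have h1 : ‖∫ θ in S, g θ * conj (fhat N c θ)‖ ≤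
      ∫ θ in S, ((1/2) * ‖g θ‖ ^ 2 + (1/2) * ‖fhat N c θ‖ ^ 2) := by
    refine norm_integral_le_of_norm_le ((i1.const_mul _).add (i2.const_mul _)) ?_
    refine Filter.Eventually.of_forall fun θ => ?_
    simp only [norm_mul, RCLike.norm_conj]
    nlinarith [sq_nonneg (‖g θ‖ - ‖fhat N c θ‖)]
  rw [integral_add (i1.const_mul _) (i2.const_mul _), integral_const_mul, integral_const_mul] at h1
  have h3 : ∫ θ in S, ‖fhat N c θ‖ ^ 2 ≤ ∫ θ in Set.Icc (0:ℝ) 1, ‖fhat N c θ‖ ^ 2 := by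
    refine setIntegral_mono_set (cir (by fun_prop) le_rfl) ?_ hS.eventuallyLE
    exact Filter.Eventually.of_forall fun θ => by simp only [Pi.zero_apply]; positivity
  rw [parseval] at h3
  linarith

lemma cell_symm {N K q n m : ℕ} (hn : n ∈ Finset.Icc 1 N) (h : m ∈ cell N K q n) :
    n ∈ cell N K q m := by
  simp only [cell, Finset.mem_filter] at h ⊢
  exact ⟨hn, h.2.1.symm, h.2.2.symm⟩

lemma cell_eq {N K q n m : ℕ} (h : m ∈ cell N K q n) : cell N K q m = cell N K q n := by
  simp only [cell, Finset.mem_filter] at h ⊢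
  rw [h.2.1, h.2.2]

lemma self_cell {N K q n : ℕ} (hn : n ∈ Finset.Icc 1 N) : n ∈ cell N K q n := by
  simp [cell] at hn ⊢; exact hn

lemma cell_sub {N K q n : ℕ} : cell N K q n ⊆ Finset.Icc 1 N := Finset.filter_subset _ _

lemma cell_card {N K q n : ℕ} (hn : n ∈ Finset.Icc 1 N) : (0:ℝ) < (cell N K q n).card := by
  exact_mod_cast Finset.card_pos.mpr ⟨n, self_cell hn⟩

lemma contraction (N K q : ℕ) (g : ℕ → ℂ) :
    ∑ n ∈ Finset.Icc 1 N, ‖condExp N K q g n‖ ≤ ∑ n ∈ Finset.Icc 1 N, ‖g n‖ := by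
  calc ∑ n ∈ Finset.Icc 1 N, ‖condExp N K q g n‖
      ≤ ∑ n ∈ Finset.Icc 1 N, ∑ m ∈ cell N K q n, ‖g m‖ / (cell N K q m).card := by
        refine Finset.sum_le_sum fun n hn => ?_
        rw [Finset.sum_congr rfl (fun m hm => by rw [cell_eq hm]), ← Finset.sum_div]
        unfold condExp
        rw [norm_div, Complex.norm_natCast]
        gcongr
        exact norm_sum_le _ _
    _ = ∑ m ∈ Finset.Icc 1 N, ∑ n ∈ cell N K q m, ‖g m‖ / (cell N K q m).card := by
        refine Finset.sum_comm' fun n m => ?_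
        constructor
        · rintro ⟨h1, h2⟩; exact ⟨cell_symm h1 h2, cell_sub h2⟩
        · rintro ⟨h1, h2⟩; exact ⟨cell_sub h1, cell_symm h2 h1⟩
    _ = ∑ n ∈ Finset.Icc 1 N, ‖g n‖ := by
        refine Finset.sum_congr rfl fun m hm => ?_
        have := cell_card (K := K) (q := q) hm
        rw [Finset.sum_const, nsmul_eq_mul]
        field_simp

lemma near_aux {N K n m : ℕ} (hN : 0 < N) (hK : 0 < K) (hn : n ≤ N) (hm : m ≤ N)
    (h : cellIdx N K n = cellIdx N K m) : n * K ≤ m * K + N := by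
  unfold cellIdx at h
  have h1 := Nat.div_add_mod (n * K) N
  have h2 := Nat.mod_lt (n * K) hN
  have h3 := Nat.div_add_mod (m * K) N
  have h4 : n * K ≤ N * K := Nat.mul_le_mul_right _ hn
  set a := n * K / N
  set b := m * K / N
  by_cases hb : b + 1 ≤ K
  · have hab : a ≤ b ∨ K ≤ b + 1 := by omega
    rcases hab with hab | hab
    · have := Nat.mul_le_mul_left N hab
      omega
    · have := Nat.mul_le_mul_left N hab
      rw [Nat.mul_add] at this
      omega
  · have := Nat.mul_le_mul_left N (show K ≤ b by omega)
    omega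

lemma near {N K q n m : ℕ} (hK : 0 < K) (hn : n ∈ Finset.Icc 1 N) (h : m ∈ cell N K q n) :
    |(n:ℝ) - m| ≤ (N:ℝ) / K ∧ ∃ t : ℤ, (n:ℤ) - m = q * t := by
  simp only [cell, Finset.mem_filter, Finset.mem_Icc] at h hn
  have hN : 0 < N := by omega
  have h1 := near_aux hN hK hn.2 h.1.2 h.2.1.symm
  have h2 := near_aux hN hK h.1.2 hn.2 h.2.1
  have h1' : (n:ℝ) * K ≤ m * K + N := by exact_mod_cast h1
  have h2' : (m:ℝ) * K ≤ n * K + N := by exact_mod_cast h2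
  have hK' : (0:ℝ) < K := by exact_mod_cast hK
  refine ⟨?_, ?_⟩
  · rw [le_div_iff₀ hK']
    rcases abs_cases ((n:ℝ) - m) with h | h <;> rw [h.1] <;> linarith
  · have : (n:ℤ) ≡ m [ZMOD q] := (Int.natCast_modEq_iff).2 h.2.2.symm
    obtain ⟨t, ht⟩ := this.symm.dvd
    exact ⟨t, ht⟩

def marc (N q₀ q : ℕ) : Set ℝ := {θ : ℝ | ∃ a : ℤ, |θ - (a : ℝ) / (q : ℝ)| ≤ (q₀ : ℝ) / (N : ℝ)}

lemma marc_meas (N q₀ q : ℕ) : MeasurableSet (marc N q₀ q) := by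
  have : marc N q₀ q = ⋃ a : ℤ, {θ : ℝ | |θ - (a : ℝ) / (q : ℝ)| ≤ (q₀ : ℝ) / (N : ℝ)} := by
    ext; simp [marc]
  rw [this]
  refine MeasurableSet.iUnion fun a => ?_
  exact (isClosed_le (by fun_prop) (by fun_prop)).measurableSet

lemma marc_vol {N q₀ q : ℕ} (hq : 0 < q) (h : (q:ℝ) * q₀ / N < 1) :
    volume.real (Set.Icc (0:ℝ) 1 ∩ marc N q₀ q) ≤ 4 * q * q₀ / N := by
  have hq' : (0:ℝ) < q := by exact_mod_cast hq
  have hq1 : (1:ℝ) ≤ q := by exact_mod_cast hq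
  have hsub : Set.Icc (0:ℝ) 1 ∩ marc N q₀ q ⊆
      ⋃ a ∈ Finset.range (q+1), Set.Icc ((a:ℝ)/q - q₀ / N) ((a:ℝ)/q + q₀/N) := by
    rintro θ ⟨⟨h0, h1⟩, a, ha⟩
    rw [abs_le] at ha
    have e : (q:ℝ) * ((a:ℝ)/q) = a := by field_simp
    have e2 : (q:ℝ) * (q₀ / N) = q * q₀ / N := by ring
    have a1 : (-1:ℝ) < a := by nlinarith
    have a2 : (a:ℝ) < q + 1 := by nlinarith
    have a1' : (-1:ℤ) < a := by exact_mod_cast a1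
    have a2' : a < (q:ℤ) + 1 := by exact_mod_cast a2
    obtain ⟨b, rfl⟩ := Int.eq_ofNat_of_zero_le (show 0 ≤ a by omega)
    simp only [Set.mem_iUnion]
    refine ⟨b, by simp; omega, ?_⟩
    simp only [Int.cast_natCast] at ha
    constructor <;> linarith
  have hnn : (0:ℝ) ≤ q₀ / N := by positivity
  calc volume.real (Set.Icc (0:ℝ) 1 ∩ marc N q₀ q)
      ≤ volume.real (⋃ a ∈ Finset.range (q+1), Set.Icc ((a:ℝ)/q - q₀ / N) ((a:ℝ)/q + q₀/N)) := by
        refine measureReal_mono hsub ?_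
        refine ((measure_biUnion_finset_le _ _).trans_lt ?_).ne
        refine ENNReal.sum_lt_top.2 fun a _ => by simp
    _ ≤ ∑ a ∈ Finset.range (q+1), volume.real (Set.Icc ((a:ℝ)/q - q₀ / N) ((a:ℝ)/q + q₀/N)) :=
        measureReal_biUnion_finset_le _ _
    _ = (q+1) * (2 * (q₀ / N)) := by
        rw [Finset.sum_congr rfl (fun a _ => by
          rw [Real.volume_real_Icc_of_le (by linarith),
            show (a:ℝ)/q + q₀/N - ((a:ℝ)/q - q₀ / N) = 2 * (q₀/N) by ring])]
        simp
    _ ≤ 4 * q * q₀ / N := by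
        rw [show 4 * (q:ℝ) * q₀ / N = 2 * q * (2 * (q₀ / N)) by ring]
        gcongr; linarith

lemma ee_diff {N K q₀ q n m : ℕ} (hN : 0 < N) (hK : 0 < K) (hq : 0 < q) (h1 : |(n:ℝ) - m| ≤ (N:ℝ) / K)
    (h2 : ∃ t : ℤ, (n:ℤ) - m = q * t) {θ : ℝ} (hθ : θ ∈ marc N q₀ q) :
    ‖conj (ee n θ) - conj (ee m θ)‖ ≤ 2 * Real.pi * q₀ / K := by
  obtain ⟨t, ht⟩ := h2
  obtain ⟨a, ha⟩ := hθ
  have hq' : (q:ℂ) ≠ 0 := by exact_mod_cast hq.ne'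
  have hN' : (0:ℝ) < N := by exact_mod_cast hN
  have ht' : (n:ℂ) - m = q * t := by exact_mod_cast congrArg (Int.cast : ℤ → ℂ) ht
  have hn : ee n θ = ee m θ * Complex.exp (Complex.I * ((2 * Real.pi * (n - m) * (θ - a/q) : ℝ) : ℂ)) := by
    unfold ee
    rw [← Complex.exp_add, Complex.exp_eq_exp_iff_exists_int]
    refine ⟨t * a, ?_⟩
    push_cast
    rw [ht', show (n:ℂ) = m + q * t by rw [← ht']; ring]
    field_simp
    ring
  rw [← map_sub, RCLike.norm_conj, hn, show ∀ x y : ℂ, x * y - x = x * (y - 1) by intros; ring,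
    norm_mul, ee_norm, one_mul]
  refine (Real.norm_exp_I_mul_ofReal_sub_one_le).trans ?_
  rw [Real.norm_eq_abs, abs_mul, abs_mul, abs_of_pos Real.two_pi_pos]
  calc 2 * Real.pi * |(n:ℝ) - m| * |θ - a / q| ≤ 2 * Real.pi * ((N:ℝ)/K) * (q₀ / N) := by
        gcongr
    _ = _ := by field_simp

lemma fhat_norm (N : ℕ) (f : ℕ → ℂ) (θ : ℝ) : ‖fhat N f θ‖ ≤ ∑ n ∈ Finset.Icc 1 N, ‖f n‖ := by
  rw [fhat_eq]
  refine (norm_sum_le _ _).trans (le_of_eq ?_)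
  simp [ee_norm]

lemma condExp_dist {N K q n : ℕ} (g : ℕ → ℂ) (B : ℝ) (hn : n ∈ Finset.Icc 1 N)
    (h : ∀ m ∈ cell N K q n, ‖g n - g m‖ ≤ B) : ‖g n - condExp N K q g n‖ ≤ B := by
  have hc := cell_card (K := K) (q := q) hn
  have hc' : ((cell N K q n).card : ℂ) ≠ 0 := by exact_mod_cast hc.ne'
  have : g n - condExp N K q g n = (∑ m ∈ cell N K q n, (g n - g m)) / (cell N K q n).card := by
    unfold condExp
    rw [Finset.sum_sub_distrib, Finset.sum_const, nsmul_eq_mul]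
    field_simp
  rw [this, norm_div, Complex.norm_natCast, div_le_iff₀ hc]
  refine (norm_sum_le_of_le _ h).trans (le_of_eq ?_)
  rw [Finset.sum_const, nsmul_eq_mul, mul_comm]

lemma condExp_add (N K q : ℕ) (g h f : ℕ → ℂ) (H : ∀ n ∈ Finset.Icc 1 N, f n = g n + h n) (n : ℕ) :
    condExp N K q f n = condExp N K q g n + condExp N K q h n := by
  unfold condExp
  rw [← add_div, ← Finset.sum_add_distrib, Finset.sum_congr rfl fun m hm => H m (cell_sub hm)]

/-- **Conditional expectation is controlled by the Fourier transform off the non-standard major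
arcs** (Lemma 9.2 of Bourgain–Kontorovich): for `q·q₀² = o(K₁)`,
`‖f − E_{q,K₁}f‖_{ℓ¹[1,N]} ≪ N^{1/2}·‖1_{[0,1]∖𝔐̃}·f̂‖_{L²[0,1]} + o(‖f‖_{ℓ¹})`, where
`𝔐̃ = ∪_{a=1}^q [a/q − q₀/N, a/q + q₀/N]` taken modulo `1`. -/
theorem conditional_expectation_minor_arcs_bound :
    ∃ C : ℝ, 0 < C ∧ ∀ ε : ℝ, 0 < ε → ∃ δ : ℝ, 0 < δ ∧
      ∀ (N q₀ q K₁ : ℕ) (f : ℕ → ℂ),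
        0 < q₀ → q₀ ≤ q → 0 < K₁ → K₁ ≤ N →
        (q : ℝ) * (q₀ : ℝ) ^ 2 ≤ δ * (K₁ : ℝ) →
        ∑ n ∈ Finset.Icc 1 N, ‖f n - condExp N K₁ q f n‖ ≤
          C * Real.sqrt (N : ℝ) *
              Real.sqrt (∫ θ in Set.Icc (0 : ℝ) 1 \
                  {θ : ℝ | ∃ a : ℤ, |θ - (a : ℝ) / (q : ℝ)| ≤ (q₀ : ℝ) / (N : ℝ)},
                ‖fhat N f θ‖ ^ 2)
            + ε * ∑ n ∈ Finset.Icc 1 N, ‖f n‖ := by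
  refine ⟨2, by norm_num, fun ε hε => ⟨min (1/2) (ε / (8 * Real.pi)), by positivity, ?_⟩⟩
  intro N q₀ q K₁ f hq₀ hqq hK hKN hδ
  change _ ≤ 2 * Real.sqrt (N : ℝ) *
    Real.sqrt (∫ θ in Set.Icc (0 : ℝ) 1 \ marc N q₀ q, ‖fhat N f θ‖ ^ 2) + _
  have hN : 0 < N := by omega
  have hq : 0 < q := by omega
  have hN' : (0:ℝ) < N := by exact_mod_cast hN
  have hK' : (0:ℝ) < K₁ := by exact_mod_cast hK
  have hKN' : (K₁:ℝ) ≤ N := by exact_mod_cast hKN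
  have hq1 : (1:ℝ) ≤ q₀ := by exact_mod_cast hq₀
  have d1 : (q:ℝ) * q₀ ^ 2 ≤ 1/2 * K₁ := hδ.trans (by gcongr; exact min_le_left _ _)
  have d2 : (q:ℝ) * q₀ ^ 2 ≤ ε / (8 * Real.pi) * K₁ := hδ.trans (by gcongr; exact min_le_right _ _)
  have hlt : (q:ℝ) * q₀ / N < 1 := by
    rw [div_lt_one hN']
    have : (q:ℝ) * q₀ ≤ q * q₀ ^ 2 := by gcongr; nlinarith
    linarith
  set F := ∑ n ∈ Finset.Icc 1 N, ‖f n‖ with hF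
  have hF0 : 0 ≤ F := by positivity
  set S := Set.Icc (0 : ℝ) 1 \ marc N q₀ q with hS
  set M := Set.Icc (0 : ℝ) 1 ∩ marc N q₀ q with hM
  have hSs : S ⊆ Set.Icc 0 1 := Set.diff_subset
  have hMs : M ⊆ Set.Icc 0 1 := Set.inter_subset_left
  have hMm : MeasurableSet M := measurableSet_Icc.inter (marc_meas _ _ _)
  obtain ⟨c, hc⟩ : ∃ c : ℕ → ℂ, ∀ n, c n = ∫ θ in S, fhat N f θ * conj (ee n θ) := ⟨_, fun _ => rfl⟩
  obtain ⟨g, hg⟩ : ∃ g : ℕ → ℂ, ∀ n, g n = ∫ θ in M, fhat N f θ * conj (ee n θ) := ⟨_, fun _ => rfl⟩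
  have hcont : ∀ n, Continuous fun θ => fhat N f θ * conj (ee n θ) := fun n =>
    (fhat_cont N f).mul (conj_cont (ee_cont n))
  have hsplit : ∀ n ∈ Finset.Icc 1 N, f n = g n + c n := by
    intro n hn
    rw [hg, hc, ← coeff N f hn]
    exact (integral_inter_add_diff (marc_meas _ _ _) (ci (hcont n) le_rfl)).symm
  have hB := bessel N (fhat_cont N f) hSs c hc
  -- minor part
  have hl1 : ∑ n ∈ Finset.Icc 1 N, ‖c n‖ ≤ Real.sqrt N * Real.sqrt (∫ θ in S, ‖fhat N f θ‖ ^ 2) := by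
    rw [← Real.sqrt_mul hN'.le]
    refine Real.le_sqrt_of_sq_le ?_
    have := sq_sum_le_card_mul_sum_sq (s := Finset.Icc 1 N) (f := fun n => ‖c n‖)
    simp only [Nat.card_Icc, Nat.add_sub_cancel] at this
    exact this.trans (by gcongr)
  have hvol : volume.real M ≤ 4 * q * q₀ / N := marc_vol hq hlt
  have hmaj : ∀ n ∈ Finset.Icc 1 N, ‖g n - condExp N K₁ q g n‖ ≤ ε * F / N := by
    intro n hn
    refine condExp_dist g _ hn fun m hm => ?_
    obtain ⟨h1, h2⟩ := near hK hn hm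
    rw [hg, hg, ← integral_sub (ci (hcont n) hMs) (ci (hcont m) hMs)]
    have hfin : volume M < ⊤ := (measure_mono hMs).trans_lt (by simp)
    have := norm_setIntegral_le_of_norm_le_const (μ := volume) (s := M)
      (f := fun θ => fhat N f θ * conj (ee n θ) - fhat N f θ * conj (ee m θ))
      (C := F * (2 * Real.pi * q₀ / K₁)) hfin (by
        intro θ hθ
        rw [← mul_sub, norm_mul]
        exact mul_le_mul (fhat_norm N f θ) (ee_diff hN hK hq h1 h2 hθ.2) (norm_nonneg _) hF0)
    refine this.trans ?_
    calc F * (2 * Real.pi * q₀ / K₁) * volume.real M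
        ≤ F * (2 * Real.pi * q₀ / K₁) * (4 * q * q₀ / N) := by gcongr
      _ = F / N * (8 * Real.pi / K₁ * (q * q₀ ^ 2)) := by field_simp; ring
      _ ≤ F / N * (8 * Real.pi / K₁ * (ε / (8 * Real.pi) * K₁)) := by gcongr
      _ = ε * F / N := by field_simp
  calc ∑ n ∈ Finset.Icc 1 N, ‖f n - condExp N K₁ q f n‖
      ≤ ∑ n ∈ Finset.Icc 1 N, (ε * F / N + (‖c n‖ + ‖condExp N K₁ q c n‖)) := by
        refine Finset.sum_le_sum fun n hn => ?_
        rw [condExp_add N K₁ q g c f hsplit, hsplit n hn,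
          show g n + c n - (condExp N K₁ q g n + condExp N K₁ q c n)
            = (g n - condExp N K₁ q g n) + (c n - condExp N K₁ q c n) by ring]
        exact (norm_add_le _ _).trans (add_le_add (hmaj n hn) (norm_sub_le _ _))
    _ = ε * F + (∑ n ∈ Finset.Icc 1 N, ‖c n‖ + ∑ n ∈ Finset.Icc 1 N, ‖condExp N K₁ q c n‖) := by
        rw [Finset.sum_add_distrib, Finset.sum_add_distrib, Finset.sum_const, nsmul_eq_mul]
        simp only [Nat.card_Icc, Nat.add_sub_cancel]
        congr 1
        field_simp
    _ ≤ _ := by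
        have := contraction N K₁ q c
        linarith
end

section
/- (Randomness extraction) There is an absolute constant C₁ > 0 such that the following holds. Let S ⊂ SL₂(ℤ) be a finite nonempty set with uniform probability measure μ, let η > 0, let Q ≥ 2, let q₀ ≥ 1 be an integer and ω₀ ∈ SL₂(ℤ/q₀ℤ), and let 𝔔 be the set of positive integers q ≤ Q divisible by q₀. Suppose that for every q ∈ 𝔔 and every ω ∈ SL₂(ℤ/qℤ) with ω ≡ ω₀ (mod q₀): | μ({γ ∈ S : γ ≡ ω (mod q)}) − |SL₂(ℤ/q₀ℤ)|/|SL₂(ℤ/qℤ)| | < η. Then for every integer T with η⁻²·log Q < T ≤ |S| there exist distinct points γ₁,…,γ_T ∈ S such that for every q ∈ 𝔔 and every ω ∈ SL₂(ℤ/qℤ) with ω ≡ ω₀ (mod q₀): | (1/T)·#{1 ≤ i ≤ T : γᵢ ≡ ω (mod q)} − |SL₂(ℤ/q₀ℤ)|/|SL₂(ℤ/qℤ)| | ≤ C₁·η. -/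
open scoped Classical

/-- Reduction of `SL₂(ℤ)` modulo `q`. -/
def redMod (q : ℕ) :
    Matrix.SpecialLinearGroup (Fin 2) ℤ →* Matrix.SpecialLinearGroup (Fin 2) (ZMod q) :=
  Matrix.SpecialLinearGroup.map (Int.castRingHom (ZMod q))

/-- Further reduction from level `q` to level `q₀` when `q₀ ∣ q`. -/
def redDvd {q₀ q : ℕ} (h : q₀ ∣ q) :
    Matrix.SpecialLinearGroup (Fin 2) (ZMod q) →*
      Matrix.SpecialLinearGroup (Fin 2) (ZMod q₀) :=
  Matrix.SpecialLinearGroup.map (ZMod.castHom h (ZMod q₀))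

lemma aux_mgf {α : Type*} [DecidableEq α] (S B : Finset α) (hB : B ⊆ S) (p T l : ℝ) (hp0 : 0 ≤ p) (hp1 : p ≤ 1)
    (hpT : p * (S.card : ℝ) = T) (hl : |l| ≤ 1) :
    ∑ A ∈ S.powerset, (p ^ A.card * (1 - p) ^ (S \ A).card) *
      Real.exp (l * (((A ∩ B).card : ℝ) - p * B.card)) ≤ Real.exp (l ^ 2 * T) := by
  have key : ∑ A ∈ S.powerset, (p ^ A.card * (1 - p) ^ (S \ A).card) *
      Real.exp (l * ((A ∩ B).card : ℝ)) = (1 + p * (Real.exp l - 1)) ^ B.card := by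
    have h := Finset.prod_add (fun i => p * (if i ∈ B then Real.exp l else 1))
      (fun _ => (1 - p)) S
    have h2 : ∏ i ∈ S, (p * (if i ∈ B then Real.exp l else 1) + (1 - p))
        = (1 + p * (Real.exp l - 1)) ^ B.card := by
      rw [← Finset.prod_subset hB]
      · rw [← Finset.prod_const]
        apply Finset.prod_congr rfl
        intro i hi
        rw [if_pos hi]; ring
      · intro i _ hi
        rw [if_neg hi]; ring
    rw [← h2, h]
    apply Finset.sum_congr rfl
    intro A _
    rw [Finset.prod_mul_distrib, Finset.prod_const, Finset.prod_const, Finset.prod_ite_mem,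
      Finset.prod_const, ← Real.exp_nat_mul]
    rw [mul_comm l]
    ring
  have e1 : ∀ A : Finset α, (p ^ A.card * (1 - p) ^ (S \ A).card) *
      Real.exp (l * (((A ∩ B).card : ℝ) - p * B.card)) =
      ((p ^ A.card * (1 - p) ^ (S \ A).card) * Real.exp (l * ((A ∩ B).card : ℝ)))
        * Real.exp (- (l * p * B.card)) := by
    intro A
    rw [mul_assoc _ (Real.exp _) (Real.exp _), ← Real.exp_add]
    congr 2; ring
  simp_rw [e1]
  rw [← Finset.sum_mul, key]
  have hexp := Real.abs_exp_sub_one_sub_id_le hl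
  have hexp2 := (abs_le.1 hexp).2
  have hbase : 1 + p * (Real.exp l - 1) ≤ Real.exp (p * (l + l ^ 2)) := by
    have := Real.add_one_le_exp (p * (l + l ^ 2))
    nlinarith
  have hb0 : 0 ≤ 1 + p * (Real.exp l - 1) := by
    have := Real.exp_pos l
    nlinarith [mul_nonneg hp0 this.le]
  calc _ ≤ Real.exp (p * (l + l ^ 2)) ^ B.card * Real.exp (- (l * p * B.card)) := by
        gcongr
    _ = Real.exp (l ^ 2 * (p * B.card)) := by
        rw [← Real.exp_nat_mul, ← Real.exp_add]; congr 1; ring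
    _ ≤ _ := by
        apply Real.exp_le_exp.2
        apply mul_le_mul_of_nonneg_left _ (sq_nonneg l)
        rw [← hpT]
        apply mul_le_mul_of_nonneg_left _ hp0
        exact_mod_cast Finset.card_le_card hB

lemma aux_random {α : Type*} [DecidableEq α] (S : Finset α) (F : Finset (Finset α)) (hF : ∀ B ∈ F, B ⊆ S)
    (p T l : ℝ) (hp0 : 0 ≤ p) (hp1 : p ≤ 1)
    (hpT : p * (S.card : ℝ) = T) (hl0 : 0 < l) (hl : l ≤ 1)
    (hcard : 2 * (F.card : ℝ) < Real.exp (l ^ 2 * T)) :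
    ∃ A ⊆ S, ∀ B ∈ F, |((A ∩ B).card : ℝ) - p * B.card| ≤ 2 * l * T := by
  by_contra! hcon
  set w : Finset α → ℝ := fun A => p ^ A.card * (1 - p) ^ (S \ A).card with hw
  have hw0 : ∀ A, 0 ≤ w A := fun A =>
    mul_nonneg (pow_nonneg hp0 _) (pow_nonneg (by linarith) _)
  have hw1 : ∑ A ∈ S.powerset, w A = 1 := by
    have h := Finset.prod_add (fun _ : α => p) (fun _ => (1 - p)) S
    simp only [Finset.prod_const] at h
    rw [← h]; simp
  let X : Finset α → Finset α → ℝ := fun A B => ((A ∩ B).card : ℝ) - p * B.card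
  have hlow : Real.exp (2 * l ^ 2 * T) ≤ ∑ A ∈ S.powerset, w A *
      ∑ B ∈ F, (Real.exp (l * X A B) + Real.exp ((-l) * X A B)) := by
    calc Real.exp (2 * l ^ 2 * T) = ∑ A ∈ S.powerset, w A * Real.exp (2 * l ^ 2 * T) := by
          rw [← Finset.sum_mul, hw1, one_mul]
      _ ≤ _ := by
          apply Finset.sum_le_sum
          intro A hA
          apply mul_le_mul_of_nonneg_left _ (hw0 A)
          obtain ⟨B, hB, hX⟩ := hcon A (Finset.mem_powerset.1 hA)
          have h1 : Real.exp (2 * l ^ 2 * T) ≤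
              Real.exp (l * X A B) + Real.exp ((-l) * X A B) := by
            have p1 := Real.exp_pos (l * X A B)
            have p2 := Real.exp_pos ((-l) * X A B)
            rcases lt_abs.1 hX with h | h
            · have : Real.exp (2 * l ^ 2 * T) ≤ Real.exp (l * X A B) := by
                apply Real.exp_le_exp.2
                have := mul_le_mul_of_nonneg_left h.le hl0.le
                calc _ = l * (2 * l * T) := by ring
                  _ ≤ _ := this
              linarith
            · have : Real.exp (2 * l ^ 2 * T) ≤ Real.exp ((-l) * X A B) := by
                apply Real.exp_le_exp.2
                have := mul_le_mul_of_nonneg_left h.le hl0.le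
                calc _ = l * (2 * l * T) := by ring
                  _ ≤ _ := this
                  _ = _ := by simp only [X]; ring
              linarith
          refine h1.trans ?_
          exact Finset.single_le_sum
            (f := fun B => Real.exp (l * X A B) + Real.exp ((-l) * X A B))
            (fun B _ => by positivity) hB
  have hup : ∑ A ∈ S.powerset, w A *
      ∑ B ∈ F, (Real.exp (l * X A B) + Real.exp ((-l) * X A B)) ≤
      F.card * (2 * Real.exp (l ^ 2 * T)) := by
    simp_rw [Finset.mul_sum]
    rw [Finset.sum_comm, ← nsmul_eq_mul]
    apply Finset.sum_le_card_nsmul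
    intro B hB
    simp_rw [mul_add]
    rw [Finset.sum_add_distrib]
    have a1 := aux_mgf S B (hF B hB) p T l hp0 hp1 hpT (by rwa [abs_of_pos hl0])
    have a2 := aux_mgf S B (hF B hB) p T (-l) hp0 hp1 hpT (by rwa [abs_neg, abs_of_pos hl0])
    rw [neg_sq] at a2
    simp only [X, hw]
    linarith
  have h3 := hlow.trans hup
  have h4 : Real.exp (2 * l ^ 2 * T) = Real.exp (l ^ 2 * T) * Real.exp (l ^ 2 * T) := by
    rw [← Real.exp_add]; congr 1; ring
  rw [h4] at h3
  nlinarith [Real.exp_pos (l ^ 2 * T)]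

lemma aux_exact {α : Type*} [DecidableEq α] (S : Finset α) (F : Finset (Finset α)) (hF : ∀ B ∈ F, B ⊆ S)
    (T : ℕ) (l : ℝ) (hT0 : 0 < T) (hT : T ≤ S.card) (hl0 : 0 < l) (hl : l ≤ 1)
    (hcard : 2 * ((F.card : ℝ) + 1) < Real.exp (l ^ 2 * T)) :
    ∃ A ⊆ S, A.card = T ∧
      ∀ B ∈ F, |((A ∩ B).card : ℝ) / T - (B.card : ℝ) / S.card| ≤ 4 * l := by
  have hT0' : (0 : ℝ) < T := by exact_mod_cast hT0
  have hn : (0 : ℝ) < S.card := by exact_mod_cast hT0.trans_le hT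
  have hTn : (T : ℝ) ≤ S.card := by exact_mod_cast hT
  obtain ⟨A, hAS, hA⟩ := aux_random S (insert S F)
    (by intro B hB; rcases Finset.mem_insert.1 hB with rfl | h
        · exact subset_rfl
        · exact hF B h)
    ((T : ℝ) / S.card) T l (by positivity) (by rw [div_le_one hn]; exact hTn)
    (by field_simp) hl0 hl
    (by
      refine lt_of_le_of_lt ?_ hcard
      have := Finset.card_insert_le S F
      have h2 : ((insert S F).card : ℝ) ≤ F.card + 1 := by exact_mod_cast this
      linarith)
  have hS := hA S (Finset.mem_insert_self _ _)
  rw [Finset.inter_eq_left.2 hAS, div_mul_cancel₀ _ hn.ne'] at hS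
  have main : ∃ A' ⊆ S, A'.card = T ∧ ∀ B : Finset α,
      |((A' ∩ B).card : ℝ) - (A ∩ B).card| ≤ |(A.card : ℝ) - T| := by
    have mono : ∀ U V B : Finset α, U ⊆ V →
        (U ∩ B).card ≤ (V ∩ B).card ∧ (V ∩ B).card + U.card ≤ (U ∩ B).card + V.card := by
      intro U V B h
      refine ⟨Finset.card_le_card (Finset.inter_subset_inter_right h), ?_⟩
      have h1 := Finset.card_inter_add_card_sdiff U B
      have h2 := Finset.card_inter_add_card_sdiff V B
      have h3 := Finset.card_le_card (Finset.sdiff_subset_sdiff h (le_refl B))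
      omega
    rcases le_total A.card T with h | h
    · obtain ⟨A', h1, h2, h3⟩ := Finset.exists_subsuperset_card_eq hAS h hT
      refine ⟨A', h2, h3, fun B => ?_⟩
      obtain ⟨m1, m2⟩ := mono A A' B h1
      rw [h3] at m2
      have m1' : ((A ∩ B).card : ℝ) ≤ (A' ∩ B).card := by exact_mod_cast m1
      have m2' : ((A' ∩ B).card : ℝ) + A.card ≤ (A ∩ B).card + T := by exact_mod_cast m2
      rw [abs_of_nonneg (by linarith), abs_sub_comm, abs_of_nonneg (by
        have : (A.card : ℝ) ≤ T := by exact_mod_cast h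
        linarith)]
      linarith
    · obtain ⟨A', h1, h3⟩ := Finset.exists_subset_card_eq h
      refine ⟨A', h1.trans hAS, h3, fun B => ?_⟩
      obtain ⟨m1, m2⟩ := mono A' A B h1
      rw [h3] at m2
      have m1' : ((A' ∩ B).card : ℝ) ≤ (A ∩ B).card := by exact_mod_cast m1
      have m2' : ((A ∩ B).card : ℝ) + T ≤ (A' ∩ B).card + A.card := by exact_mod_cast m2
      rw [abs_sub_comm, abs_of_nonneg (by linarith), abs_of_nonneg (by
        have : (T : ℝ) ≤ A.card := by exact_mod_cast h
        linarith)]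
      linarith
  obtain ⟨A', h1, h2, h3⟩ := main
  refine ⟨A', h1, h2, fun B hB => ?_⟩
  have hb := hA B (Finset.mem_insert_of_mem hB)
  have hb2 := (h3 B).trans hS
  have e : ((A' ∩ B).card : ℝ) / T - (B.card : ℝ) / S.card =
      ((((A' ∩ B).card : ℝ) - (A ∩ B).card) + (((A ∩ B).card : ℝ) - T / S.card * B.card)) / T := by
    field_simp
    ring
  rw [e, abs_div, abs_of_pos hT0', div_le_iff₀ hT0']
  refine (abs_add_le _ _).trans ?_
  linarith

lemma aux_card_SL (q : ℕ) (hq : 0 < q) :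
    Finite (Matrix.SpecialLinearGroup (Fin 2) (ZMod q)) ∧
    Nat.card (Matrix.SpecialLinearGroup (Fin 2) (ZMod q)) ≤ q ^ 4 := by
  have : NeZero q := ⟨hq.ne'⟩
  have : Finite (Matrix (Fin 2) (Fin 2) (ZMod q)) :=
    inferInstanceAs (Finite (Fin 2 → Fin 2 → ZMod q))
  have hinj : Function.Injective
      (fun g : Matrix.SpecialLinearGroup (Fin 2) (ZMod q) => (g : Matrix (Fin 2) (Fin 2) (ZMod q))) :=
    Subtype.val_injective
  refine ⟨Finite.of_injective _ hinj, ?_⟩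
  refine (Nat.card_le_card_of_injective _ hinj).trans ?_
  have : Nat.card (Fin 2 → Fin 2 → ZMod q) = q ^ 4 := by
    simp [Nat.card_eq_fintype_card, ZMod.card]
    ring
  exact this.le

lemma aux_family (S : Finset (Matrix.SpecialLinearGroup (Fin 2) ℤ)) (N : ℕ) :
    ∃ F : Finset (Finset (Matrix.SpecialLinearGroup (Fin 2) ℤ)),
      (∀ B ∈ F, B ⊆ S) ∧ F.card ≤ N ^ 5 ∧
      ∀ q : ℕ, 0 < q → q ≤ N → ∀ ω : Matrix.SpecialLinearGroup (Fin 2) (ZMod q),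
        S.filter (fun γ => redMod q γ = ω) ∈ F := by
  have hone : ∀ q : ℕ, ∃ G : Finset (Finset (Matrix.SpecialLinearGroup (Fin 2) ℤ)),
      0 < q → (∀ B ∈ G, B ⊆ S) ∧ G.card ≤ q ^ 4 ∧
      ∀ ω : Matrix.SpecialLinearGroup (Fin 2) (ZMod q),
        S.filter (fun γ => redMod q γ = ω) ∈ G := by
    intro q
    by_cases hq : 0 < q
    · obtain ⟨hfin, hc⟩ := aux_card_SL q hq
      have := Fintype.ofFinite (Matrix.SpecialLinearGroup (Fin 2) (ZMod q))
      refine ⟨Finset.univ.image (fun ω : Matrix.SpecialLinearGroup (Fin 2) (ZMod q) =>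
        S.filter (fun γ => redMod q γ = ω)), fun _ => ⟨?_, ?_, ?_⟩⟩
      · intro B hB
        obtain ⟨ω, _, rfl⟩ := Finset.mem_image.1 hB
        exact Finset.filter_subset _ _
      · refine Finset.card_image_le.trans ?_
        rw [Finset.card_univ, ← Nat.card_eq_fintype_card]
        exact hc
      · intro ω
        exact Finset.mem_image_of_mem _ (Finset.mem_univ _)
    · exact ⟨∅, fun h => absurd h hq⟩
  choose G hG using hone
  refine ⟨(Finset.Icc 1 N).biUnion G, ?_, ?_, ?_⟩
  · intro B hB
    obtain ⟨q, hq, hB⟩ := Finset.mem_biUnion.1 hB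
    exact (hG q (Finset.mem_Icc.1 hq).1).1 B hB
  · have := Finset.card_biUnion_le_card_mul (Finset.Icc 1 N) G (N ^ 4) (fun q hq => by
      have hq := Finset.mem_Icc.1 hq
      exact ((hG q hq.1).2.1).trans (Nat.pow_le_pow_left hq.2 4))
    rw [Nat.card_Icc] at this
    refine this.trans (le_of_eq ?_)
    simp; ring
  · intro q hq hqN ω
    exact Finset.mem_biUnion.2 ⟨q, Finset.mem_Icc.2 ⟨hq, hqN⟩, (hG q hq).2.2 ω⟩

lemma aux_count {α : Type*} [DecidableEq α] (A : Finset α) (T : ℕ) (h : A.card = T) :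
    ∃ g : Fin T → α, Function.Injective g ∧ (∀ i, g i ∈ A) ∧
      ∀ (P : α → Prop) [DecidablePred P], (Finset.univ.filter (fun i => P (g i))).card = (A.filter P).card := by
  let e := A.equivFinOfCardEq h
  have hinj : Function.Injective (fun i => (e.symm i : α)) :=
    Subtype.val_injective.comp e.symm.injective
  refine ⟨fun i => (e.symm i : α), hinj, fun i => (e.symm i).2, fun P _ => ?_⟩
  rw [← Finset.card_image_of_injective _ hinj]
  congr 1
  ext x
  simp only [Finset.mem_image, Finset.mem_filter, Finset.mem_univ, true_and]
  constructor
  · rintro ⟨i, hi, rfl⟩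
    exact ⟨(e.symm i).2, hi⟩
  · rintro ⟨hx, hP⟩
    exact ⟨e ⟨x, hx⟩, by simpa using hP, by simp⟩

/-- **Randomness extraction** (Lemma 10.9 of Bourgain–Kontorovich): if the uniform measure on a
finite set `S ⊂ SL₂(ℤ)` projects `η`-uniformly to `SL₂(ℤ/qℤ)` (conditioned on a fixed residue
`ω₀` mod `q₀`) for every modulus `q ≤ Q` divisible by `q₀`, then for every
`T > η⁻²·log Q` with `T ≤ |S|` there are `T` distinct points of `S` whose uniform measure has
the same property, up to an absolute constant `C₁`. -/
theorem randomness_extraction :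
    ∃ C₁ : ℝ, 0 < C₁ ∧
      ∀ (S : Finset (Matrix.SpecialLinearGroup (Fin 2) ℤ)) (η Q : ℝ) (q₀ : ℕ)
        (ω₀ : Matrix.SpecialLinearGroup (Fin 2) (ZMod q₀)),
        S.Nonempty → 0 < η → 2 ≤ Q → 0 < q₀ →
        (∀ q : ℕ, 0 < q → (q : ℝ) ≤ Q → ∀ h : q₀ ∣ q,
          ∀ ω : Matrix.SpecialLinearGroup (Fin 2) (ZMod q), redDvd h ω = ω₀ →
            |((S.filter (fun γ => redMod q γ = ω)).card : ℝ) / (S.card : ℝ)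
                - (Nat.card (Matrix.SpecialLinearGroup (Fin 2) (ZMod q₀)) : ℝ)
                  / (Nat.card (Matrix.SpecialLinearGroup (Fin 2) (ZMod q)) : ℝ)| < η) →
        ∀ T : ℕ, η⁻¹ ^ 2 * Real.log Q < (T : ℝ) → T ≤ S.card →
          ∃ g : Fin T → Matrix.SpecialLinearGroup (Fin 2) ℤ,
            Function.Injective g ∧ (∀ i, g i ∈ S) ∧
            ∀ q : ℕ, 0 < q → (q : ℝ) ≤ Q → ∀ h : q₀ ∣ q,
              ∀ ω : Matrix.SpecialLinearGroup (Fin 2) (ZMod q), redDvd h ω = ω₀ →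
                |((Finset.univ.filter (fun i : Fin T => redMod q (g i) = ω)).card : ℝ)
                      / (T : ℝ)
                    - (Nat.card (Matrix.SpecialLinearGroup (Fin 2) (ZMod q₀)) : ℝ)
                      / (Nat.card (Matrix.SpecialLinearGroup (Fin 2) (ZMod q)) : ℝ)|
                  ≤ C₁ * η := by
  refine ⟨13, by norm_num, ?_⟩
  intro S η Q q₀ ω₀ hS hη hQ hq₀ hyp T hT hTS
  have hlog : 0 < Real.log Q := Real.log_pos (by linarith)
  have hT0' : (0 : ℝ) < T := lt_of_le_of_lt (by positivity) hT
  have hT0 : 0 < T := by exact_mod_cast hT0'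
  by_cases hbig : 3 * η ≤ 1
  · obtain ⟨F, hF1, hF2, hF3⟩ := aux_family S ⌊Q⌋₊
    have hFQ : (F.card : ℝ) ≤ Q ^ 5 := by
      have h1 : (F.card : ℝ) ≤ (⌊Q⌋₊ : ℝ) ^ 5 := by exact_mod_cast hF2
      exact h1.trans (pow_le_pow_left₀ (by positivity) (Nat.floor_le (by linarith)) 5)
    have hexp : Q ^ 9 < Real.exp ((3 * η) ^ 2 * T) := by
      have h1 : Real.log Q < η ^ 2 * T := by
        have := mul_lt_mul_of_pos_left hT (show 0 < η ^ 2 by positivity)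
        rwa [← mul_assoc, ← mul_pow, mul_inv_cancel₀ hη.ne', one_pow, one_mul] at this
      calc Q ^ 9 = Real.exp (9 * Real.log Q) := by
            have := Real.exp_nat_mul (Real.log Q) 9
            rw [Real.exp_log (by linarith)] at this
            rw [← this]; norm_num
        _ < _ := by
            apply Real.exp_lt_exp.2
            nlinarith
    have hcard : 2 * ((F.card : ℝ) + 1) < Real.exp ((3 * η) ^ 2 * T) := by
      refine lt_of_le_of_lt ?_ hexp
      have h1 : (1 : ℝ) ≤ Q ^ 5 := one_le_pow₀ (by linarith)
      have h2 : (2 : ℝ) ^ 4 ≤ Q ^ 4 := pow_le_pow_left₀ (by norm_num) hQ 4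
      have h3 : Q ^ 9 = Q ^ 4 * Q ^ 5 := by ring
      rw [h3]
      nlinarith
    obtain ⟨A, hAS, hAc, hA⟩ := aux_exact S F hF1 T (3 * η) hT0 hTS (by positivity) hbig hcard
    obtain ⟨g, hg1, hg2, hg3⟩ := aux_count A T hAc
    refine ⟨g, hg1, fun i => hAS (hg2 i), ?_⟩
    intro q hq hqQ h ω hω
    have b1 := hyp q hq hqQ h ω hω
    have b2 := hA _ (hF3 q hq (Nat.le_floor hqQ) ω)
    have e : A ∩ S.filter (fun γ => redMod q γ = ω) = A.filter (fun γ => redMod q γ = ω) := by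
      rw [Finset.inter_filter, Finset.inter_eq_left.2 hAS]
    rw [e] at b2
    rw [hg3 (fun γ => redMod q γ = ω)]
    refine (abs_sub_le _ _ _).trans ((add_le_add b2 b1.le).trans ?_)
    linarith
  · obtain ⟨A, hAS, hAc⟩ := Finset.exists_subset_card_eq hTS
    obtain ⟨g, hg1, hg2, hg3⟩ := aux_count A T hAc
    refine ⟨g, hg1, fun i => hAS (hg2 i), ?_⟩
    intro q hq hqQ h ω hω
    have b1 := hyp q hq hqQ h ω hω
    have hn : (0 : ℝ) < S.card := by exact_mod_cast hS.card_pos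
    have c1 : ((S.filter (fun γ => redMod q γ = ω)).card : ℝ) / (S.card : ℝ) ≤ 1 := by
      rw [div_le_one hn]
      exact_mod_cast Finset.card_filter_le _ _
    have c0 : 0 ≤ ((S.filter (fun γ => redMod q γ = ω)).card : ℝ) / (S.card : ℝ) := by positivity
    rw [hg3 (fun γ => redMod q γ = ω)]
    have d1 : ((A.filter (fun γ => redMod q γ = ω)).card : ℝ) / (T : ℝ) ≤ 1 := by
      rw [div_le_one hT0', ← hAc]
      exact_mod_cast Finset.card_filter_le _ _
    have d0 : 0 ≤ ((A.filter (fun γ => redMod q γ = ω)).card : ℝ) / (T : ℝ) := by positivity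
    rw [abs_lt] at b1
    rw [abs_le]
    constructor <;> linarith [b1.1, b1.2]
end

section
/- Let p be a prime and n an integer, and let c_p(m) = ∑_{a=1}^{p−1} e^{2πiam/p} denote the Ramanujan sum. Then ∑_{γ ∈ SL₂(ℤ/pℤ)} c_p(d(γ) − n) = p if p ∤ n, and = −p(p−1) if p | n, where d(γ) denotes the lower-right entry of γ. Equivalently, (1/|SL₂(ℤ/pℤ)|)·∑_{γ ∈ SL₂(ℤ/pℤ)} c_p(d(γ) − n) equals 1/(p²−1) if p ∤ n and −1/(p+1) if p | n. -/
/-- The Ramanujan sum `c_p(m) = ∑_{a=1}^{p−1} e^{2πiam/p}`. -/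
noncomputable def ramanujanC (p : ℕ) (m : ℤ) : ℂ :=
  ∑ a ∈ Finset.Icc 1 (p - 1),
    Complex.exp (2 * Real.pi * Complex.I * (a : ℂ) * (m : ℂ) / (p : ℂ))

lemma rc_eval (p : ℕ) [hp : Fact p.Prime] (m : ℤ) :
    ramanujanC p m = (if (m : ZMod p) = 0 then (p : ℂ) else 0) - 1 := by
  have hp0 : (p : ℂ) ≠ 0 := by exact_mod_cast hp.out.ne_zero
  have hpi : (2 * Real.pi * Complex.I : ℂ) ≠ 0 := Complex.two_pi_I_ne_zero
  have h1 : ramanujanC p m + 1 = ∑ a ∈ Finset.range p,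
      (Complex.exp (2 * Real.pi * Complex.I * (m : ℂ) / (p : ℂ))) ^ a := by
    obtain ⟨k, hk⟩ : ∃ k, p = k + 1 := ⟨p - 1, by have := hp.out.pos; omega⟩
    have e : Finset.Icc 1 (p - 1) = Finset.Ico 1 p := by
      ext x; simp only [Finset.mem_Icc, Finset.mem_Ico]; omega
    rw [Finset.range_eq_Ico, Finset.sum_eq_sum_Ico_succ_bot hp.out.pos, pow_zero, add_comm,
      ramanujanC, e]
    congr 1
    refine Finset.sum_congr rfl fun a _ => ?_
    rw [← Complex.exp_nat_mul]
    congr 1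
    ring
  rw [eq_sub_iff_add_eq, h1]
  have h2 : Complex.exp (2 * Real.pi * Complex.I * (m : ℂ) / (p : ℂ)) = 1 ↔ (m : ZMod p) = 0 := by
    rw [Complex.exp_eq_one_iff, ZMod.intCast_zmod_eq_zero_iff_dvd]
    constructor
    · rintro ⟨n, hn⟩
      refine ⟨n, ?_⟩
      rw [div_eq_iff hp0] at hn
      have : (m : ℂ) = p * n := by
        apply mul_left_cancel₀ hpi
        rw [hn]; ring
      exact_mod_cast this
    · rintro ⟨n, rfl⟩
      refine ⟨n, ?_⟩
      push_cast
      field_simp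
  split_ifs with h
  · rw [h2.2 h]; simp
  · have h3 : Complex.exp (2 * Real.pi * Complex.I * (m : ℂ) / (p : ℂ)) ≠ 1 := fun h' => h (h2.1 h')
    rw [geom_sum_eq h3, ← Complex.exp_nat_mul]
    have : (p : ℂ) * (2 * Real.pi * Complex.I * (m : ℂ) / (p : ℂ)) = m * (2 * Real.pi * Complex.I) := by
      field_simp
    rw [this, Complex.exp_int_mul_two_pi_mul_I]
    simp

def fibEquiv {F : Type*} [Field F] (d : F) (hd : d ≠ 0) :
    {γ : Matrix.SpecialLinearGroup (Fin 2) F // γ.1 1 1 = d} ≃ F × F where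
  toFun γ := (γ.1.1 0 1, γ.1.1 1 0)
  invFun x := ⟨⟨!![(1 + x.1 * x.2) / d, x.1; x.2, d], by
    rw [Matrix.det_fin_two_of]; field_simp; ring⟩, by simp⟩
  left_inv := by
    rintro ⟨γ, h⟩
    have hdet := γ.2
    rw [Matrix.det_fin_two, h] at hdet
    have ha : (1 + γ.1 0 1 * γ.1 1 0) / d = γ.1 0 0 := by
      rw [div_eq_iff hd]; linear_combination -hdet
    apply Subtype.ext
    apply Subtype.ext
    ext i j
    fin_cases i <;> fin_cases j
    · exact ha
    · rfl
    · rfl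
    · exact h.symm
  right_inv x := rfl

def fibEquivZero {F : Type*} [Field F] :
    {γ : Matrix.SpecialLinearGroup (Fin 2) F // γ.1 1 1 = 0} ≃ F × Fˣ where
  toFun γ := (γ.1.1 0 0, ⟨γ.1.1 1 0, - γ.1.1 0 1, by
      have hdet := γ.1.2
      rw [Matrix.det_fin_two, γ.2] at hdet
      linear_combination hdet, by
      have hdet := γ.1.2
      rw [Matrix.det_fin_two, γ.2] at hdet
      linear_combination hdet⟩)
  invFun x := ⟨⟨!![x.1, -(x.2⁻¹ : Fˣ); x.2, 0], by
    rw [Matrix.det_fin_two_of]; simp⟩, by simp⟩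
  left_inv := by
    rintro ⟨γ, h⟩
    apply Subtype.ext
    apply Subtype.ext
    ext i j
    fin_cases i <;> fin_cases j
    · rfl
    · exact neg_neg _
    · rfl
    · exact h.symm
  right_inv x := by
    refine Prod.ext rfl (Units.ext rfl)

lemma fib_card (p : ℕ) [hp : Fact p.Prime] (d : ZMod p) :
    ((Finset.univ.filter
      (fun γ : Matrix.SpecialLinearGroup (Fin 2) (ZMod p) => γ.1 1 1 = d)).card : ℂ)
      = (p : ℂ) ^ 2 - if d = 0 then (p : ℂ) else 0 := by
  rw [← Fintype.card_subtype]
  split_ifs with h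
  · subst h
    rw [Fintype.card_congr fibEquivZero, Fintype.card_prod, ZMod.card, ZMod.card_units,
      Nat.cast_mul, Nat.cast_sub hp.out.one_le]
    push_cast
    ring
  · rw [Fintype.card_congr (fibEquiv d h), Fintype.card_prod, ZMod.card]
    push_cast
    ring

lemma sl_card (p : ℕ) [hp : Fact p.Prime] :
    ((Finset.univ : Finset (Matrix.SpecialLinearGroup (Fin 2) (ZMod p))).card : ℂ)
      = (p : ℂ) ^ 3 - p := by
  rw [Finset.card_eq_sum_card_fiberwise (t := Finset.univ)
    (f := fun γ : Matrix.SpecialLinearGroup (Fin 2) (ZMod p) => γ.1 1 1) (by simp)]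
  push_cast
  simp_rw [fib_card]
  rw [Finset.sum_sub_distrib]
  simp [ZMod.card]
  ring

lemma main_sum (p : ℕ) [hp : Fact p.Prime] (n : ℤ) :
    ∑ γ : Matrix.SpecialLinearGroup (Fin 2) (ZMod p),
        ramanujanC p ((((γ : Matrix (Fin 2) (Fin 2) (ZMod p)) 1 1).val : ℤ) - n)
      = p - if (n : ZMod p) = 0 then (p : ℂ) ^ 2 else 0 := by
  simp_rw [rc_eval]
  push_cast
  simp_rw [ZMod.natCast_zmod_val, sub_eq_zero]
  rw [Finset.sum_sub_distrib, ← Finset.sum_filter, Finset.sum_const, Finset.sum_const,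
    nsmul_eq_mul, nsmul_eq_mul, sl_card, fib_card]
  split_ifs <;> ring

/-- **Ramanujan sums of the lower-right entry over `SL₂(ℤ/pℤ)`**: for a prime `p` and `n ∈ ℤ`,
`∑_{γ ∈ SL₂(ℤ/pℤ)} c_p(d(γ) − n)` equals `p` if `p ∤ n` and `−p(p−1)` if `p ∣ n`, where
`d(γ)` is the lower-right entry of `γ`. -/
theorem sl2_ramanujan_sum (p : ℕ) [Fact p.Prime] (n : ℤ) :
    (¬ (p : ℤ) ∣ n →
      ∑ γ : Matrix.SpecialLinearGroup (Fin 2) (ZMod p),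
        ramanujanC p ((((γ : Matrix (Fin 2) (Fin 2) (ZMod p)) 1 1).val : ℤ) - n)
        = (p : ℂ)) ∧
    ((p : ℤ) ∣ n →
      ∑ γ : Matrix.SpecialLinearGroup (Fin 2) (ZMod p),
        ramanujanC p ((((γ : Matrix (Fin 2) (Fin 2) (ZMod p)) 1 1).val : ℤ) - n)
        = -(p : ℂ) * ((p : ℂ) - 1)) := by
  have h := main_sum p n
  have hd := ZMod.intCast_zmod_eq_zero_iff_dvd n p
  constructor
  · intro hn
    rw [h, if_neg (mt hd.1 hn), sub_zero]
  · intro hn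
    rw [h, if_pos (hd.2 hn)]
    ring
end

section
/- Let A ≥ 1 and let b, d be integers with 0 < b < d, gcd(b,d) = 1, and suppose b/d admits a continued fraction expansion [a₁,…,a_k] with all partial quotients a_j ≤ A. Then 1 − b/d = (d−b)/d admits a continued fraction expansion all of whose partial quotients are at most A + 1; that is, b/d ∈ 𝔯_A implies (d−b)/d ∈ 𝔯_{A+1}. -/
open Filter

/-- Value of the finite continued fraction `[a₁,…,a_k] = 1/(a₁+1/(a₂+⋯+1/a_k))`. -/
def cfVal : List ℕ → ℚ
  | [] => 0
  | a :: l => 1 / ((a : ℚ) + cfVal l)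

/-- `q ∈ 𝔯_𝒜`: `q` is a rational in `(0,1)` admitting a continued fraction expansion with
all partial quotients in the alphabet `𝒜`. -/
def memR (A : Set ℕ) (q : ℚ) : Prop :=
  0 < q ∧ q < 1 ∧ ∃ l : List ℕ, l ≠ [] ∧ (∀ a ∈ l, a ∈ A) ∧ cfVal l = q

theorem cfVal_nonneg_aux (l : List ℕ) : 0 ≤ cfVal l := by
  induction l with
  | nil => simp [cfVal]
  | cons a l ih => simp only [cfVal]; positivity

/-- **Complement stays bounded** : if `b/d ∈ 𝔯_A` (all partial quotients at most `A`), then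
`1 − b/d = (d−b)/d ∈ 𝔯_{A+1}` (all partial quotients at most `A + 1`). -/
theorem complement_in_R_succ (A b d : ℕ) (hA : 1 ≤ A) (hb : 0 < b) (hbd : b < d)
    (hcop : Nat.Coprime b d)
    (h : memR {a : ℕ | 1 ≤ a ∧ a ≤ A} ((b : ℚ) / d)) :
    memR {a : ℕ | 1 ≤ a ∧ a ≤ A + 1} (((d - b : ℕ) : ℚ) / d) := by
  have hd : (0 : ℚ) < d := by exact_mod_cast hb.trans hbd
  have e : (((d - b : ℕ) : ℚ) / d) = 1 - (b : ℚ) / d := by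
    rw [Nat.cast_sub hbd.le]; field_simp
  rw [e]
  obtain ⟨h0, h1, l, hl, hm, hv⟩ := h
  refine ⟨by linarith, by linarith, ?_⟩
  rw [← hv] at h1 ⊢
  match l, hl, hm with
  | a :: l, _, hm =>
    have ha := hm a (by simp)
    simp only [Set.mem_setOf_eq] at ha
    have hm' : ∀ c ∈ l, 1 ≤ c ∧ c ≤ A := fun c hc => hm c (by simp [hc])
    obtain ⟨a, rfl⟩ : ∃ k, a = k + 1 := ⟨a - 1, by omega⟩
    rcases Nat.eq_zero_or_pos a with rfl | hpos
    · match l, hm' with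
      | [], _ => simp [cfVal] at h1
      | c :: l, hm' =>
        have hc := hm' c (by simp)
        refine ⟨(c + 1) :: l, by simp, ?_, ?_⟩
        · intro x hx
          rcases List.mem_cons.1 hx with rfl | hx
          · exact ⟨by omega, by omega⟩
          · have := hm' x (by simp [hx])
            exact ⟨by omega, by omega⟩
        · have hy := cfVal_nonneg_aux l
          have hc' : (0 : ℚ) < c := by exact_mod_cast hc.1
          simp only [cfVal]
          generalize cfVal l = y at *
          push_cast
          have h2 : (c : ℚ) + y ≠ 0 := by positivity
          have h3 : (c : ℚ) + 1 + y ≠ 0 := by positivity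
          have h4 : (0 : ℚ) + 1 + 1 / (c + y) ≠ 0 := by positivity
          rw [eq_sub_iff_add_eq]
          field_simp
          ring
    · refine ⟨1 :: a :: l, by simp, ?_, ?_⟩
      · intro x hx
        rcases List.mem_cons.1 hx with rfl | hx
        · exact ⟨by omega, by omega⟩
        rcases List.mem_cons.1 hx with rfl | hx
        · exact ⟨by omega, by omega⟩
        · have := hm' x hx
          exact ⟨by omega, by omega⟩
      · have hy := cfVal_nonneg_aux l
        have hc' : (0 : ℚ) < a := by exact_mod_cast hpos
        simp only [cfVal]
        generalize cfVal l = y at *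
        push_cast
        have h2 : (a : ℚ) + y ≠ 0 := by positivity
        have h3 : (a : ℚ) + 1 + y ≠ 0 := by positivity
        have h4 : (1 : ℚ) + 1 / (a + y) ≠ 0 := by positivity
        rw [eq_sub_iff_add_eq]
        field_simp
        ring
end
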